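/- (Flat-model factorization of the GJMS operators; Proposition 'flatcase' of the paper.) Let k ≥ 1 be an integer, let f be a smooth function on ℝ^N ∖ {0} homogeneous of weight k − n/2, and let A_1, …, A_{k−1} ∈ Fin N. Define f_0 = f and, for 1 ≤ j ≤ k − 1, f_j = (D^{(k−j+1−n/2)} f_{j−1})_{A_j} (so f_j is homogeneous of weight k − j − n/2). Then Δ f_{k−1} = (−1)^{k−1} · X_{A_1} · X_{A_2} ⋯ X_{A_{k−1}} · Δ^k f on ℝ^N ∖ {0}. -/

import Mathlib

open scoped BigOperators

/-- Partial derivative in the `A`-th coordinate direction. -/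
noncomputable def pd {N : ℕ} (A : Fin N) (f : (Fin N → ℝ) → ℝ) : (Fin N → ℝ) → ℝ :=
  fun x => fderiv ℝ f x (Pi.single A 1)

/-- Ambient Laplacian `Δf = ∑_{A,B} h^{AB} ∂_A ∂_B f` w.r.t. the inverse metric `hInv`. -/
noncomputable def lap {N : ℕ} (hInv : Matrix (Fin N) (Fin N) ℝ)
    (f : (Fin N → ℝ) → ℝ) : (Fin N → ℝ) → ℝ :=
  fun x => ∑ A : Fin N, ∑ B : Fin N, hInv A B * pd A (pd B f) x

/-- `X_A(x) = ∑_B h_{AB} x^B`. -/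
def Xc {N : ℕ} (h : Matrix (Fin N) (Fin N) ℝ) (A : Fin N) : (Fin N → ℝ) → ℝ :=
  fun x => ∑ B : Fin N, h A B * x B

/-- `Q(x) = ∑_{A,B} h_{AB} x^A x^B`. -/
def Qfun {N : ℕ} (h : Matrix (Fin N) (Fin N) ℝ) : (Fin N → ℝ) → ℝ :=
  fun x => ∑ A : Fin N, ∑ B : Fin N, h A B * x A * x B

/-- Smooth (C^∞) on `ℝ^N ∖ {0}`. -/
def SmoothOffZero {N : ℕ} (f : (Fin N → ℝ) → ℝ) : Prop :=
  ContDiffOn ℝ (⊤ : ℕ∞) f {x : Fin N → ℝ | x ≠ 0}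

/-- Homogeneous of weight `w` on `ℝ^N ∖ {0}`. -/
def Homog {N : ℕ} (w : ℝ) (f : (Fin N → ℝ) → ℝ) : Prop :=
  ∀ x : Fin N → ℝ, x ≠ 0 → (∑ A : Fin N, x A * pd A f x) = w * f x

/-- Ambient tractor-D operator at weight `w`: `(D^{(w)} f)_A = (n+2w−2)∂_A f − X_A Δf`. -/
noncomputable def Dop {N : ℕ} (n : ℕ) (h hInv : Matrix (Fin N) (Fin N) ℝ) (w : ℝ)
    (f : (Fin N → ℝ) → ℝ) (A : Fin N) : (Fin N → ℝ) → ℝ :=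
  fun x => ((n : ℝ) + 2 * w - 2) * pd A f x - Xc h A x * lap hInv f x

/-- Iterated tractor-D: `seqD … w0 f A 0 = f` and
`seqD … w0 f A (j+1) = (D^{(w0−j)} (seqD … w0 f A j))_{A (j+1)}`. -/
noncomputable def seqD {N : ℕ} (n : ℕ) (h hInv : Matrix (Fin N) (Fin N) ℝ)
    (w0 : ℝ) (f : (Fin N → ℝ) → ℝ) (A : ℕ → Fin N) : ℕ → (Fin N → ℝ) → ℝ
  | 0 => f
  | j + 1 => Dop n h hInv (w0 - (j : ℝ)) (seqD n h hInv w0 f A j) (A (j + 1))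

/-- `u` is `O(Q^m)`: `u = Q^m · g` for some smooth `g` on `ℝ^N ∖ {0}`. -/
def BigOQ {N : ℕ} (h : Matrix (Fin N) (Fin N) ℝ) (m : ℕ) (u : (Fin N → ℝ) → ℝ) : Prop :=
  ∃ g : (Fin N → ℝ) → ℝ, SmoothOffZero g ∧
    ∀ x : Fin N → ℝ, x ≠ 0 → u x = (Qfun h x) ^ m * g x

theorem eventually_ne_zero {N : ℕ} {x : Fin N → ℝ} (hx : x ≠ 0) : ∀ᶠ y in nhds x, y ≠ 0 :=
  isOpen_ne.mem_nhds hx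

namespace SmoothOffZero

variable {N : ℕ} {f g : (Fin N → ℝ) → ℝ}

theorem contDiffAt (hf : SmoothOffZero f) {x : Fin N → ℝ} (hx : x ≠ 0) :
    ContDiffAt ℝ (⊤ : ℕ∞) f x :=
  ContDiffOn.contDiffAt hf (isOpen_ne.mem_nhds hx)

theorem differentiableAt (hf : SmoothOffZero f) {x : Fin N → ℝ} (hx : x ≠ 0) :
    DifferentiableAt ℝ f x :=
  (hf.contDiffAt hx).differentiableAt (by simp)

theorem sub (hf : SmoothOffZero f) (hg : SmoothOffZero g) : SmoothOffZero (fun x => f x - g x) :=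
  ContDiffOn.sub hf hg

theorem mul (hf : SmoothOffZero f) (hg : SmoothOffZero g) : SmoothOffZero (fun x => f x * g x) :=
  ContDiffOn.mul hf hg

theorem const_mul (c : ℝ) (hf : SmoothOffZero f) : SmoothOffZero (fun x => c * f x) :=
  ContDiffOn.mul contDiffOn_const hf

theorem sum {ι : Type*} {s : Finset ι} {F : ι → (Fin N → ℝ) → ℝ}
    (hF : ∀ i ∈ s, SmoothOffZero (F i)) : SmoothOffZero (fun x => ∑ i ∈ s, F i x) :=
  ContDiffOn.sum hF

theorem pd (hf : SmoothOffZero f) (A : Fin N) : SmoothOffZero (pd A f) :=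
  (ContDiffOn.fderiv_of_isOpen hf isOpen_ne (by simp)).clm_apply contDiffOn_const

theorem lap (hInv : Matrix (Fin N) (Fin N) ℝ) (hf : SmoothOffZero f) :
    SmoothOffZero (lap hInv f) :=
  sum fun A _ => sum fun B _ => ((hf.pd B).pd A).const_mul _

theorem lap_iterate (hInv : Matrix (Fin N) (Fin N) ℝ) (hf : SmoothOffZero f) (m : ℕ) :
    SmoothOffZero ((_root_.lap hInv)^[m] f) := by
  induction m with
  | zero => exact hf
  | succ m ih =>
    rw [Function.iterate_succ_apply']
    exact ih.lap hInv

theorem Xc (h : Matrix (Fin N) (Fin N) ℝ) (A : Fin N) : SmoothOffZero (Xc h A) :=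
  ContDiff.contDiffOn (by unfold _root_.Xc; fun_prop)

theorem Dop (n : ℕ) (h hInv : Matrix (Fin N) (Fin N) ℝ) (w : ℝ) (hf : SmoothOffZero f)
    (A : Fin N) : SmoothOffZero (Dop n h hInv w f A) :=
  ((hf.pd A).const_mul _).sub ((Xc h A).mul (hf.lap hInv))

theorem seqD (n : ℕ) (h hInv : Matrix (Fin N) (Fin N) ℝ) (w : ℝ) (hf : SmoothOffZero f)
    (A : ℕ → Fin N) (j : ℕ) : SmoothOffZero (seqD n h hInv w f A j) := by
  induction j with
  | zero => exact hf
  | succ j ih => exact ih.Dop n h hInv _ _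

end SmoothOffZero

section OffZero

variable {N : ℕ} {f g : (Fin N → ℝ) → ℝ} {x : Fin N → ℝ}

theorem pd_congr (hfg : ∀ y, y ≠ 0 → f y = g y) (A : Fin N) (hx : x ≠ 0) :
    pd A f x = pd A g x := by
  have hev : f =ᶠ[nhds x] g := (eventually_ne_zero hx).mono hfg
  simp only [pd, hev.fderiv_eq]

theorem lap_congr (hInv : Matrix (Fin N) (Fin N) ℝ) (hfg : ∀ y, y ≠ 0 → f y = g y)
    (hx : x ≠ 0) : lap hInv f x = lap hInv g x := by
  simp only [lap]
  refine Finset.sum_congr rfl fun A _ => Finset.sum_congr rfl fun B _ => ?_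
  rw [pd_congr (fun y hy => pd_congr hfg B hy) A hx]

theorem lap_iterate_congr (hInv : Matrix (Fin N) (Fin N) ℝ) (hfg : ∀ y, y ≠ 0 → f y = g y)
    (m : ℕ) (hx : x ≠ 0) : (lap hInv)^[m] f x = (lap hInv)^[m] g x := by
  induction m generalizing x with
  | zero => exact hfg x hx
  | succ m ih =>
    simp only [Function.iterate_succ_apply']
    exact lap_congr hInv (fun y hy => ih hy) hx

theorem pd_add (hf : SmoothOffZero f) (hg : SmoothOffZero g) (A : Fin N) (hx : x ≠ 0) :
    pd A (fun y => f y + g y) x = pd A f x + pd A g x := by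
  simp [pd, fderiv_fun_add (hf.differentiableAt hx) (hg.differentiableAt hx)]

theorem pd_sub (hf : SmoothOffZero f) (hg : SmoothOffZero g) (A : Fin N) (hx : x ≠ 0) :
    pd A (fun y => f y - g y) x = pd A f x - pd A g x := by
  simp [pd, fderiv_fun_sub (hf.differentiableAt hx) (hg.differentiableAt hx)]

theorem pd_const_mul (c : ℝ) (hf : SmoothOffZero f) (A : Fin N) (hx : x ≠ 0) :
    pd A (fun y => c * f y) x = c * pd A f x := by
  simp [pd, fderiv_const_mul (hf.differentiableAt hx)]

theorem pd_mul (hf : SmoothOffZero f) (hg : SmoothOffZero g) (A : Fin N) (hx : x ≠ 0) :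
    pd A (fun y => f y * g y) x = f x * pd A g x + pd A f x * g x := by
  simp [pd, fderiv_fun_mul (hf.differentiableAt hx) (hg.differentiableAt hx), mul_comm]

theorem pd_sum {ι : Type*} {s : Finset ι} {F : ι → (Fin N → ℝ) → ℝ}
    (hF : ∀ i ∈ s, SmoothOffZero (F i)) (A : Fin N) (hx : x ≠ 0) :
    pd A (fun y => ∑ i ∈ s, F i y) x = ∑ i ∈ s, pd A (F i) x := by
  simp [pd, fderiv_fun_sum fun i hi => (hF i hi).differentiableAt hx]

theorem pd_comm (hf : SmoothOffZero f) (A B : Fin N) (hx : x ≠ 0) :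
    pd A (pd B f) x = pd B (pd A f) x := by
  have hd : DifferentiableAt ℝ (fderiv ℝ f) x :=
    ((hf.contDiffAt hx).fderiv_right (m := 1) (by norm_cast)).differentiableAt one_ne_zero
  have hpd : ∀ C D : Fin N, pd C (pd D f) x =
      fderiv ℝ (fderiv ℝ f) x (Pi.single C 1) (Pi.single D 1) := fun C D => by
    unfold pd
    rw [fderiv_clm_apply hd (differentiableAt_const _)]
    simp
  rw [hpd, hpd]
  exact ((hf.contDiffAt hx).isSymmSndFDerivAt (by simp; norm_cast)).eq _ _

theorem lap_sub (hInv : Matrix (Fin N) (Fin N) ℝ) (hf : SmoothOffZero f) (hg : SmoothOffZero g)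
    (hx : x ≠ 0) : lap hInv (fun y => f y - g y) x = lap hInv f x - lap hInv g x := by
  simp only [lap, ← Finset.sum_sub_distrib, ← mul_sub]
  refine Finset.sum_congr rfl fun A _ => Finset.sum_congr rfl fun B _ => ?_
  rw [pd_congr (fun y hy => pd_sub hf hg B hy) A hx, pd_sub (hf.pd B) (hg.pd B) A hx]

theorem lap_const_mul (hInv : Matrix (Fin N) (Fin N) ℝ) (c : ℝ) (hf : SmoothOffZero f)
    (hx : x ≠ 0) : lap hInv (fun y => c * f y) x = c * lap hInv f x := by
  simp only [lap, Finset.mul_sum]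
  refine Finset.sum_congr rfl fun A _ => Finset.sum_congr rfl fun B _ => ?_
  rw [pd_congr (fun y hy => pd_const_mul c hf B hy) A hx, pd_const_mul c (hf.pd B) A hx]
  ring

theorem lap_pd (hInv : Matrix (Fin N) (Fin N) ℝ) (hf : SmoothOffZero f) (C : Fin N)
    (hx : x ≠ 0) : lap hInv (pd C f) x = pd C (lap hInv f) x := by
  have hterm (A B : Fin N) : SmoothOffZero (fun y => hInv A B * pd A (pd B f) y) :=
    ((hf.pd B).pd A).const_mul _
  unfold lap
  rw [pd_sum (fun A _ => SmoothOffZero.sum fun B _ => hterm A B) C hx]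
  refine Finset.sum_congr rfl fun A _ => ?_
  rw [pd_sum (fun B _ => hterm A B) C hx]
  refine Finset.sum_congr rfl fun B _ => ?_
  rw [pd_const_mul _ ((hf.pd B).pd A) C hx, pd_comm (hf.pd B) C A hx,
    pd_congr (fun y hy => pd_comm hf B C hy) A hx]

end OffZero

section Metric

variable {N : ℕ} {f : (Fin N → ℝ) → ℝ} {x : Fin N → ℝ}

theorem pd_Xc (h : Matrix (Fin N) (Fin N) ℝ) (A B : Fin N) (x : Fin N → ℝ) :
    pd B (Xc h A) x = h A B := by
  have hX : HasFDerivAt (Xc h A)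
      (∑ C : Fin N, h A C • (ContinuousLinearMap.proj C : (Fin N → ℝ) →L[ℝ] ℝ)) x :=
    HasFDerivAt.fun_sum fun C _ => (hasFDerivAt_apply C x).const_mul (h A C)
  simp [pd, hX.fderiv, Pi.single_apply]

theorem pd_pd_Xc_mul (h : Matrix (Fin N) (Fin N) ℝ) (hf : SmoothOffZero f) (A B C : Fin N)
    (hx : x ≠ 0) :
    pd B (pd C (fun y => Xc h A y * f y)) x =
      Xc h A x * pd B (pd C f) x + h A B * pd C f x + h A C * pd B f x := by
  have hC : ∀ y, y ≠ 0 →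
      pd C (fun z => Xc h A z * f z) y = Xc h A y * pd C f y + h A C * f y := fun y hy => by
    rw [pd_mul (.Xc h A) hf C hy, pd_Xc]
  rw [pd_congr hC B hx, pd_add ((SmoothOffZero.Xc h A).mul (hf.pd C)) (hf.const_mul _) B hx,
    pd_mul (.Xc h A) (hf.pd C) B hx, pd_const_mul _ hf B hx, pd_Xc]

variable {h hInv : Matrix (Fin N) (Fin N) ℝ}

/-- The commutator identity `[Δ, X_A] = 2 ∂_A`. -/
theorem lap_Xc_mul (hSymm : ∀ A B, h A B = h B A) (hInvh : h * hInv = 1)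
    (hf : SmoothOffZero f) (A : Fin N) (hx : x ≠ 0) :
    lap hInv (fun y => Xc h A y * f y) x = Xc h A x * lap hInv f x + 2 * pd A f x := by
  have hleft (C : Fin N) : ∑ B, h A B * hInv B C = (1 : Matrix (Fin N) (Fin N) ℝ) A C := by
    rw [← hInvh, Matrix.mul_apply]
  have hright (B : Fin N) : ∑ C, hInv B C * h C A = (1 : Matrix (Fin N) (Fin N) ℝ) B A := by
    rw [← mul_eq_one_comm.mp hInvh, Matrix.mul_apply]
  have h₁ : ∑ B, ∑ C, hInv B C * (h A B * pd C f x) = pd A f x := by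
    rw [Finset.sum_comm]
    calc _ = ∑ C, (∑ B, h A B * hInv B C) * pd C f x := by
          simp only [Finset.sum_mul]
          exact Finset.sum_congr rfl fun C _ => Finset.sum_congr rfl fun B _ => by ring
      _ = _ := by simp [hleft, Matrix.one_apply]
  have h₂ : ∑ B, ∑ C, hInv B C * (h A C * pd B f x) = pd A f x := by
    calc _ = ∑ B, (∑ C, hInv B C * h C A) * pd B f x := by
          simp only [Finset.sum_mul]
          exact Finset.sum_congr rfl fun B _ => Finset.sum_congr rfl fun C _ => by
            rw [hSymm A C]; ring
      _ = _ := by simp [hright, Matrix.one_apply]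
  have h₀ : ∑ B, ∑ C, hInv B C * (Xc h A x * pd B (pd C f) x) = Xc h A x * lap hInv f x := by
    simp only [lap, Finset.mul_sum, mul_left_comm]
  simp only [lap, pd_pd_Xc_mul h hf A _ _ hx, mul_add, Finset.sum_add_distrib, h₁, h₂]
  rw [h₀, lap]
  ring

/-- The Laplacian intertwines the tractor-D operators of consecutive weights. -/
theorem lap_Dop (n : ℕ) (hSymm : ∀ A B, h A B = h B A) (hInvh : h * hInv = 1) (w : ℝ)
    (hf : SmoothOffZero f) (A : Fin N) (hx : x ≠ 0) :
    lap hInv (Dop n h hInv w f A) x = Dop n h hInv (w - 1) (lap hInv f) A x := by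
  unfold Dop
  rw [lap_sub hInv ((hf.pd A).const_mul _) ((SmoothOffZero.Xc h A).mul (hf.lap hInv)) hx,
    lap_const_mul hInv _ (hf.pd A) hx, lap_pd hInv hf A hx,
    lap_Xc_mul hSymm hInvh (hf.lap hInv) A hx]
  ring

theorem lap_iterate_Dop (n : ℕ) (hSymm : ∀ A B, h A B = h B A) (hInvh : h * hInv = 1)
    (A : Fin N) (m : ℕ) (w : ℝ) (hf : SmoothOffZero f) (hx : x ≠ 0) :
    (lap hInv)^[m] (Dop n h hInv w f A) x =
      Dop n h hInv (w - m) ((lap hInv)^[m] f) A x := by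
  induction m generalizing w f with
  | zero => simp
  | succ m ih =>
    rw [Function.iterate_succ_apply,
      lap_iterate_congr hInv (fun y hy => lap_Dop n hSymm hInvh w hf A hy) m hx,
      ih (w - 1) (hf.lap hInv), ← Function.iterate_succ_apply]
    congr 1
    push_cast
    ring

theorem lap_iterate_seqD (n : ℕ) (hSymm : ∀ A B, h A B = h B A) (hInvh : h * hInv = 1)
    (hf : SmoothOffZero f) (A : ℕ → Fin N) {j m k : ℕ} (hjm : j + m = k) (hx : x ≠ 0) :
    (lap hInv)^[m] (seqD n h hInv ((k : ℝ) - (n : ℝ) / 2) f A j) x =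
      (-1 : ℝ) ^ j * (∏ i ∈ Finset.Icc 1 j, Xc h (A i) x) * (lap hInv)^[k] f x := by
  induction j generalizing m with
  | zero => simp [seqD, ← hjm]
  | succ j ih =>
    have hk : (k : ℝ) = j + 1 + m := by rw [← hjm]; push_cast; ring
    rw [seqD, lap_iterate_Dop n hSymm hInvh _ m _ (hf.seqD n h hInv _ A j) hx, Dop,
      ← Function.iterate_succ_apply' (lap hInv), ih (by omega),
      Finset.prod_Icc_succ_top (by omega)]
    have hweight : (n : ℝ) + 2 * ((k : ℝ) - n / 2 - j - m) - 2 = 0 := by rw [hk]; ring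
    rw [hweight]
    ring

end Metric

/-- flat-model factorization of the GJMS operators, Proposition `flatcase`:
for `f` homogeneous of weight `k − n/2`, with `f_0 = f` and
`f_j = (D^{(k−j+1−n/2)} f_{j−1})_{A_j}`,
`Δ f_{k−1} = (−1)^{k−1} X_{A_1} ⋯ X_{A_{k−1}} Δ^k f` on `ℝ^N ∖ {0}`. -/
theorem flat_factorization
    (n : ℕ) (hn : 1 ≤ n)
    (h hInv : Matrix (Fin (n + 2)) (Fin (n + 2)) ℝ)
    (hSymm : ∀ A B, h A B = h B A) (hInvh : h * hInv = 1)
    (k : ℕ) (hk : 1 ≤ k)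
    (f : (Fin (n + 2) → ℝ) → ℝ) (hf : SmoothOffZero f)
    (hhom : Homog ((k : ℝ) - (n : ℝ) / 2) f)
    (A : ℕ → Fin (n + 2)) :
    ∀ x : Fin (n + 2) → ℝ, x ≠ 0 →
      lap hInv (seqD n h hInv ((k : ℝ) - (n : ℝ) / 2) f A (k - 1)) x
        = (-1 : ℝ) ^ (k - 1) * (∏ j ∈ Finset.Icc 1 (k - 1), Xc h (A j) x)
            * (lap hInv)^[k] f x := by
  intro x hx
  exact lap_iterate_seqD n hSymm hInvh hf A (m := 1) (by omega) hx
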